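/- Maximum principle for the minimizing movement step: Let Ω ⊂ ℝ^N bounded convex, G convex C² on (0,∞) with G'' > 0, p measurable with 1 < p⁻ ≤ p⁺ < ∞, and ρ₀ a probability density with 0 < ρ₀ ≤ M₂ a.e. for some M₂ ≥ 1/|Ω|. Then the unique minimizer ρ¹ of I(ρ) = ∫_Ω G(ρ) dx + W^h_{p(·)}(ρ₀, ρ) over probability densities satisfies ρ¹ ≤ M₂ almost everywhere. -/

import Mathlib

open MeasureTheory Real Set

/-- `ρ` is a probability density on `Ω`. -/
def IsDensityOn {N : ℕ} (Ω : Set (EuclideanSpace ℝ (Fin N))) (ρ : EuclideanSpace ℝ (Fin N) → ℝ) : Prop :=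
  Measurable ρ ∧ (∀ x, 0 ≤ ρ x) ∧ ∫ x in Ω, ρ x = 1

/-- The measure on `Ω` with density `ρ`. -/
noncomputable def densMeasure {N : ℕ} (Ω : Set (EuclideanSpace ℝ (Fin N)))
    (ρ : EuclideanSpace ℝ (Fin N) → ℝ) : Measure (EuclideanSpace ℝ (Fin N)) :=
  (volume.restrict Ω).withDensity (fun x => ENNReal.ofReal (ρ x))

/-- The set of transport plans between the densities `ρ₀` and `ρ₁` on `Ω`. -/
def Couplings {N : ℕ} (Ω : Set (EuclideanSpace ℝ (Fin N)))
    (ρ₀ ρ₁ : EuclideanSpace ℝ (Fin N) → ℝ) :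
    Set (Measure (EuclideanSpace ℝ (Fin N) × EuclideanSpace ℝ (Fin N))) :=
  {γ | IsProbabilityMeasure γ ∧ γ.map Prod.fst = densMeasure Ω ρ₀ ∧
    γ.map Prod.snd = densMeasure Ω ρ₁}

/-- The cost of the Kantorovich problem with variable exponent `p` and time step `h`. -/
noncomputable def varCost {N : ℕ} (p : EuclideanSpace ℝ (Fin N) → ℝ) (h : ℝ)
    (z : EuclideanSpace ℝ (Fin N) × EuclideanSpace ℝ (Fin N)) : ℝ :=
  ‖z.1 - z.2‖ ^ (p z.1) / (h ^ (p z.1 - 1) * p z.1)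

/-- The variable exponent Kantorovich cost `W^h_{p(·)}(ρ₀, ρ₁)`. -/
noncomputable def Wh {N : ℕ} (Ω : Set (EuclideanSpace ℝ (Fin N)))
    (p : EuclideanSpace ℝ (Fin N) → ℝ) (h : ℝ)
    (ρ₀ ρ₁ : EuclideanSpace ℝ (Fin N) → ℝ) : ℝ :=
  sInf {c : ℝ | ∃ γ ∈ Couplings Ω ρ₀ ρ₁, c = ∫ z, varCost p h z ∂γ}


lemma dm_integrable {N : ℕ} {Ω : Set (EuclideanSpace ℝ (Fin N))}
    {ρ : EuclideanSpace ℝ (Fin N) → ℝ} (hρ : IsDensityOn Ω ρ) :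
    Integrable ρ (volume.restrict Ω) := by
  by_contra hc
  have := hρ.2.2
  rw [integral_undef hc] at this
  norm_num at this

lemma dm_prob {N : ℕ} {Ω : Set (EuclideanSpace ℝ (Fin N))}
    {ρ : EuclideanSpace ℝ (Fin N) → ℝ} (hρ : IsDensityOn Ω ρ) :
    IsProbabilityMeasure (densMeasure Ω ρ) := by
  constructor
  unfold densMeasure
  rw [withDensity_apply _ MeasurableSet.univ, Measure.restrict_univ,
    ← ofReal_integral_eq_lintegral_ofReal (dm_integrable hρ) (ae_of_all _ hρ.2.1), hρ.2.2]
  simp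

lemma dm_add {N : ℕ} (Ω : Set (EuclideanSpace ℝ (Fin N)))
    {f g : EuclideanSpace ℝ (Fin N) → ℝ} (hf : Measurable f) 
    (hf0 : ∀ x, 0 ≤ f x) (hg0 : ∀ x, 0 ≤ g x) :
    densMeasure Ω (fun x => f x + g x) = densMeasure Ω f + densMeasure Ω g := by
  unfold densMeasure
  rw [← withDensity_add_left (by fun_prop)]
  congr 1
  ext x
  simp [ENNReal.ofReal_add (hf0 x) (hg0 x)]

lemma dm_smul {N : ℕ} (Ω : Set (EuclideanSpace ℝ (Fin N)))
    {f : EuclideanSpace ℝ (Fin N) → ℝ} (hf : Measurable f) {c : ℝ} (hc : 0 ≤ c) :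
    densMeasure Ω (fun x => c * f x) = ENNReal.ofReal c • densMeasure Ω f := by
  unfold densMeasure
  rw [← withDensity_smul _ (by fun_prop)]
  congr 1
  ext x
  simp [ENNReal.ofReal_mul hc]

lemma dm_sub {N : ℕ} {Ω : Set (EuclideanSpace ℝ (Fin N))}
    {ρ : EuclideanSpace ℝ (Fin N) → ℝ} (hρ : IsDensityOn Ω ρ)
    {ν : Measure (EuclideanSpace ℝ (Fin N))} (hν : ν ≤ densMeasure Ω ρ)
    {S : Set (EuclideanSpace ℝ (Fin N))} (hS : MeasurableSet S) (hνS : ν Sᶜ = 0) :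
    ∃ v : EuclideanSpace ℝ (Fin N) → ℝ, Measurable v ∧ (∀ x, 0 ≤ v x) ∧ (∀ x, v x ≤ ρ x) ∧
      (∀ x, x ∉ S → v x = 0) ∧ ν = densMeasure Ω v := by
  have i1 := dm_prob hρ
  have i2 : IsFiniteMeasure ν := isFiniteMeasure_of_le _ hν
  obtain ⟨μ, hμ⟩ : ∃ μ, μ = densMeasure Ω ρ := ⟨_, rfl⟩
  rw [← hμ] at hν i1
  have i3 : SigmaFinite μ := inferInstance
  have i4 : SFinite ν := inferInstance
  have i5 : ν.HaveLebesgueDecomposition μ := Measure.haveLebesgueDecomposition_of_sigmaFinite _ _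
  set f := ν.rnDeriv μ with hf
  have hfm : Measurable f := Measure.measurable_rnDeriv _ _
  have h1 : f ≤ᵐ[μ] 1 := Measure.rnDeriv_le_one_of_le hν
  have h2 : μ.withDensity f = ν := Measure.withDensity_rnDeriv_eq _ _ (Measure.absolutelyContinuous_of_le hν)
  let g : EuclideanSpace ℝ (Fin N) → ℝ := S.indicator (fun x => (min (f x) 1).toReal)
  have hg0 : ∀ x, 0 ≤ g x := fun x => indicator_nonneg (fun _ _ => ENNReal.toReal_nonneg) x
  have hg1 : ∀ x, g x ≤ 1 := by
    intro x
    refine indicator_le' (fun x _ => ?_) (fun _ _ => zero_le_one) x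
    exact ENNReal.toReal_le_of_le_ofReal zero_le_one (by simp)
  have hgm : Measurable g := Measurable.indicator (by fun_prop) hS
  refine ⟨fun x => ρ x * g x, hρ.1.mul hgm, fun x => mul_nonneg (hρ.2.1 x) (hg0 x), 
    fun x => mul_le_of_le_one_right (hρ.2.1 x) (hg1 x), fun x hx => by simp [g, hx], ?_⟩
  have h3 : densMeasure Ω (fun x => ρ x * g x) = μ.withDensity (fun x => ENNReal.ofReal (g x)) := by
    rw [hμ]
    unfold densMeasure
    rw [← withDensity_mul _ (by have := hρ.1; fun_prop) (by fun_prop)]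
    congr 1
    ext x
    simp [ENNReal.ofReal_mul (hρ.2.1 x)]
  rw [h3]
  have h4 : (fun x => ENNReal.ofReal (g x)) =ᵐ[μ] S.indicator f := by
    filter_upwards [h1] with x hx
    by_cases hxS : x ∈ S
    · have : min (f x) 1 = f x := min_eq_left hx
      simp only [g, indicator_of_mem hxS, this]
      rw [ENNReal.ofReal_toReal]
      exact ne_top_of_le_ne_top ENNReal.one_ne_top hx
    · simp [g, hxS]
  rw [withDensity_congr_ae h4, withDensity_indicator hS, ← restrict_withDensity hS, h2]
  symm
  rw [Measure.restrict_eq_self_of_ae_mem]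
  exact hνS

lemma dm_integral {N : ℕ} {Ω : Set (EuclideanSpace ℝ (Fin N))}
    {v : EuclideanSpace ℝ (Fin N) → ℝ} (hv : Measurable v) (hv0 : ∀ x, 0 ≤ v x) 
    [IsFiniteMeasure (densMeasure Ω v)] :
    Integrable v (volume.restrict Ω) ∧ ∫ x in Ω, v x = (densMeasure Ω v).real univ := by
  have h1 : (densMeasure Ω v) univ = ∫⁻ x in Ω, ENNReal.ofReal (v x) := by
    unfold densMeasure
    rw [withDensity_apply _ MeasurableSet.univ, Measure.restrict_univ]
  constructor
  · refine ⟨hv.aestronglyMeasurable, ?_⟩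
    rw [hasFiniteIntegral_iff_ofReal (ae_of_all _ hv0), ← h1]
    exact measure_lt_top _ _
  · rw [integral_eq_lintegral_of_nonneg_ae (ae_of_all _ hv0) hv.aestronglyMeasurable, ← h1]
    rfl

lemma dm_dom {N : ℕ} {Ω : Set (EuclideanSpace ℝ (Fin N))} (hΩ : MeasurableSet Ω)
    {v : EuclideanSpace ℝ (Fin N) → ℝ} : ∀ᵐ x ∂(densMeasure Ω v), x ∈ Ω := 
  (withDensity_absolutelyContinuous _ _).ae_le (ae_restrict_mem hΩ)

lemma G_up {G : ℝ → ℝ} (hGconv : ConvexOn ℝ (Ici 0) G)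
    (hGsm : ContDiffOn ℝ 2 G (Ioi 0)) {a b T : ℝ} (ha : 0 ≤ a) (hab : a ≤ b) (hbT : b ≤ T)
    (hT : 0 < T) : G b - G a ≤ deriv G T * (b - a) := by
  have hd : ∀ x ∈ Ioi (0:ℝ), DifferentiableAt ℝ G x := fun x hx =>
    ((hGsm.differentiableOn (by norm_num)) x hx).differentiableAt (isOpen_Ioi.mem_nhds hx)
  rcases hab.eq_or_lt with rfl | hlt
  · simp
  have hb : 0 < b := by linarith
  have h1 := hGconv.slope_le_of_hasDerivAt (x := a) (y := b) ha hb.le hlt (hd b hb).hasDerivAt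
  have h2 := (hGconv.subset Ioi_subset_Ici_self (convex_Ioi 0)).monotoneOn_deriv hd hb hT hbT
  rw [slope_def_field, div_le_iff₀ (by linarith)] at h1
  nlinarith

lemma G_down {G : ℝ → ℝ} (hGconv : ConvexOn ℝ (Ici 0) G)
    (hGsm : ContDiffOn ℝ 2 G (Ioi 0)) {a b T : ℝ} (hab : b ≤ a) (hbT : T ≤ b)
    (hT : 0 < T) : G b - G a ≤ - (deriv G T * (a - b)) := by
  have hd : ∀ x ∈ Ioi (0:ℝ), DifferentiableAt ℝ G x := fun x hx =>
    ((hGsm.differentiableOn (by norm_num)) x hx).differentiableAt (isOpen_Ioi.mem_nhds hx)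
  rcases hab.eq_or_lt with rfl | hlt
  · simp
  have hb : 0 < b := by linarith
  have h1 := hGconv.le_slope_of_hasDerivAt (x := b) (y := a) hb.le (by simp; linarith) hlt (hd b hb).hasDerivAt
  have h2 := (hGconv.subset Ioi_subset_Ici_self (convex_Ioi 0)).monotoneOn_deriv hd hT hb hbT
  rw [slope_def_field, le_div_iff₀ (by linarith)] at h1
  nlinarith

lemma G_bdd {G : ℝ → ℝ} (hGconv : ConvexOn ℝ (Ici 0) G)
    (hGsm : ContDiffOn ℝ 2 G (Ioi 0)) {K : ℝ} (hK : 0 ≤ K) : 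
    ∃ B, ∀ t, 0 ≤ t → t ≤ K → |G t| ≤ B := by
  have hd : ∀ x ∈ Ioi (0:ℝ), DifferentiableAt ℝ G x := fun x hx =>
    ((hGsm.differentiableOn (by norm_num)) x hx).differentiableAt (isOpen_Ioi.mem_nhds hx)
  refine ⟨max (max (G 0) (G K)) (-(G 1 - |deriv G 1| * (K + 1))), fun t ht htK => ?_⟩
  rw [abs_le]
  constructor
  · have key : G 1 + deriv G 1 * (t - 1) ≤ G t := by
      rcases le_total t 1 with h1 | h1
      · have := G_up hGconv hGsm (T := 1) ht h1 le_rfl one_pos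
        linarith
      · have := G_down hGconv hGsm (T := 1) h1 le_rfl one_pos
        linarith
    have h2 : - (|deriv G 1| * (K + 1)) ≤ deriv G 1 * (t - 1) := by
      have : |deriv G 1 * (t - 1)| ≤ |deriv G 1| * (K + 1) := by
        rw [abs_mul]
        gcongr
        rw [abs_le]; constructor <;> linarith
      exact (abs_le.1 this).1
    have := le_max_right (max (G 0) (G K)) (-(G 1 - |deriv G 1| * (K + 1)))
    linarith
  · refine le_trans ?_ (le_max_left _ _)
    exact hGconv.le_max_of_mem_Icc (x := 0) (y := K) (by simp) (by simpa using hK) ⟨ht, htK⟩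

lemma G_meas {G : ℝ → ℝ} (hGsm : ContDiffOn ℝ 2 G (Ioi 0)) {α : Type*} [MeasurableSpace α]
    {f : α → ℝ} (hf : Measurable f) (hf0 : ∀ x, 0 ≤ f x) : Measurable (fun x => G (f x)) := by
  have h1 : Measurable ((Ioi (0:ℝ)).indicator G) := by
    have := hGsm.continuousOn.measurable_piecewise (g := fun _ => (0:ℝ)) continuousOn_const measurableSet_Ioi 
    convert this using 1
    ext x; simp [indicator, piecewise]
  have h2 : Measurable (fun t => (Ioi (0:ℝ)).indicator G t + ({0} : Set ℝ).indicator (fun _ => G 0) t) :=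
    h1.add (measurable_const.indicator (measurableSet_singleton 0))
  convert h2.comp hf using 1
  ext x
  rcases (hf0 x).eq_or_lt with h | h
  · simp [← h]
  · simp [h, h.ne']

lemma G_eps {G : ℝ → ℝ} (hGsm : ContDiffOn ℝ 2 G (Ioi 0)) {M c : ℝ} (hM : 0 < M) (hc : 0 < c) :
    ∃ ε : ℝ, 0 < ε ∧ ε < 1 ∧ deriv G (M * (1 + ε)) - deriv G (M * (1 - ε)) < c := by
  have hcont := hGsm.continuousOn_deriv_of_isOpen isOpen_Ioi (by norm_num)
  have hc1 : ContinuousAt (deriv G) M := hcont.continuousAt (isOpen_Ioi.mem_nhds hM)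
  have h1 : ContinuousAt (fun ε : ℝ => deriv G (M * (1 + ε)) - deriv G (M * (1 - ε))) 0 := by
    apply ContinuousAt.sub
    · apply ContinuousAt.comp (g := deriv G) (by simpa using hc1) (by fun_prop)
    · apply ContinuousAt.comp (g := deriv G) (by simpa using hc1) (by fun_prop)
  have h2 : ∀ᶠ ε in nhds (0:ℝ), deriv G (M * (1 + ε)) - deriv G (M * (1 - ε)) < c :=
    h1.eventually_lt_const (by simpa using hc)
  have h3 : ∀ᶠ ε in nhdsWithin (0:ℝ) (Ioi 0), ε < 1 := 
    Filter.Eventually.filter_mono nhdsWithin_le_nhds (eventually_lt_nhds one_pos)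
  obtain ⟨ε, ⟨h5, h6⟩, h7⟩ := ((h2.filter_mono nhdsWithin_le_nhds).and h3 |>.and self_mem_nhdsWithin).exists
  exact ⟨ε, h7, h6, h5⟩


lemma cost_meas {N : ℕ} {p : EuclideanSpace ℝ (Fin N) → ℝ} (hp : Measurable p) (h : ℝ) :
    Measurable (varCost p h) := by
  unfold varCost
  fun_prop

lemma cost_bdd {N : ℕ} {Ω : Set (EuclideanSpace ℝ (Fin N))} (hΩbd : Bornology.IsBounded Ω)
    {p : EuclideanSpace ℝ (Fin N) → ℝ} {pm pp : ℝ} (hpm : 1 < pm)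
    (hbd : ∀ x ∈ Ω, pm ≤ p x ∧ p x ≤ pp) {h : ℝ} (hh : 0 < h) :
    ∃ C, ∀ x ∈ Ω, ∀ y ∈ Ω, 0 ≤ varCost p h (x, y) ∧ varCost p h (x, y) ≤ C := by
  obtain ⟨D, hD⟩ := Metric.isBounded_iff.1 hΩbd
  refine ⟨(max D 1) ^ pp / ((min h 1) ^ pp), fun x hx y hy => ?_⟩
  obtain ⟨h1, h2⟩ := hbd x hx
  have hm : 0 < min h 1 := lt_min hh one_pos
  unfold varCost
  simp only
  constructor
  · have : 0 < p x := by linarith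
    positivity
  · have hn : ‖x - y‖ ≤ max D 1 := by
      rw [← dist_eq_norm]; exact (hD hx hy).trans (le_max_left _ _)
    apply div_le_div₀
    · positivity
    · calc ‖x - y‖ ^ p x ≤ (max D 1) ^ p x := by gcongr; linarith
        _ ≤ (max D 1) ^ pp := by gcongr; exact le_max_right _ _
    · positivity
    · have e1 : (min h 1) ^ pp ≤ h ^ (p x - 1) := 
        calc (min h 1) ^ pp ≤ (min h 1) ^ (p x - 1) := 
              rpow_le_rpow_of_exponent_ge hm (min_le_right _ _) (by linarith)
          _ ≤ h ^ (p x - 1) := by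
              gcongr
              · linarith
              · exact min_le_left _ _
      have e2 : 0 < h ^ (p x - 1) := by positivity
      nlinarith

lemma cost_lb {N : ℕ} {Ω : Set (EuclideanSpace ℝ (Fin N))} 
    {p : EuclideanSpace ℝ (Fin N) → ℝ} {pm pp : ℝ} (hpm : 1 < pm)
    (hbd : ∀ x ∈ Ω, pm ≤ p x ∧ p x ≤ pp) (hne : Ω.Nonempty) {h : ℝ} (hh : 0 < h) 
    {δ : ℝ} (hδ : 0 < δ) :
    ∃ c, 0 < c ∧ ∀ x ∈ Ω, ∀ y ∈ Ω, δ ≤ dist x y → c ≤ varCost p h (x, y) := by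
  have hpp : 0 < pp := by
    obtain ⟨x, hx⟩ := hne
    linarith [(hbd x hx).1, (hbd x hx).2]
  have hd : 0 < min δ 1 := lt_min hδ one_pos
  refine ⟨(min δ 1) ^ pp / ((max h 1) ^ pp * pp), by positivity, fun x hx y hy hxy => ?_⟩
  obtain ⟨h1, h2⟩ := hbd x hx
  unfold varCost
  simp only
  rw [dist_eq_norm] at hxy
  have hp0 : 0 < p x := by linarith
  apply div_le_div₀
  · positivity
  · calc (min δ 1) ^ pp ≤ (min δ 1) ^ p x := 
          rpow_le_rpow_of_exponent_ge hd (min_le_right _ _) (by linarith)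
      _ ≤ ‖x - y‖ ^ p x := by
          gcongr
          exact (min_le_left _ _).trans hxy
  · positivity
  · gcongr
    calc h ^ (p x - 1) ≤ (max h 1) ^ (p x - 1) := by
          gcongr
          · linarith
          · exact le_max_left _ _
      _ ≤ (max h 1) ^ pp := by
          gcongr
          · exact le_max_right _ _
          · linarith

lemma cost_diag {N : ℕ} {p : EuclideanSpace ℝ (Fin N) → ℝ} {h : ℝ} {x : EuclideanSpace ℝ (Fin N)}
    (hx : p x ≠ 0) : varCost p h (x, x) = 0 := by
  simp [varCost, zero_rpow hx]

lemma coup_dom {N : ℕ} {Ω : Set (EuclideanSpace ℝ (Fin N))} (hΩ : MeasurableSet Ω)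
    {ρ₀ ρ₁ : EuclideanSpace ℝ (Fin N) → ℝ}
    {γ : Measure (EuclideanSpace ℝ (Fin N) × EuclideanSpace ℝ (Fin N))}
    (hγ : γ ∈ Couplings Ω ρ₀ ρ₁) : ∀ᵐ z ∂γ, z.1 ∈ Ω ∧ z.2 ∈ Ω := by
  obtain ⟨_, h1, h2⟩ := hγ
  have a1 : ∀ᵐ x ∂(γ.map Prod.fst), x ∈ Ω := by rw [h1]; exact dm_dom hΩ
  have a2 : ∀ᵐ x ∂(γ.map Prod.snd), x ∈ Ω := by rw [h2]; exact dm_dom hΩ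
  exact (ae_of_ae_map measurable_fst.aemeasurable a1).and
    (ae_of_ae_map measurable_snd.aemeasurable a2)

lemma coup_int {N : ℕ} {Ω : Set (EuclideanSpace ℝ (Fin N))} (hΩ : MeasurableSet Ω)
    (hΩbd : Bornology.IsBounded Ω)
    {p : EuclideanSpace ℝ (Fin N) → ℝ} (hp : Measurable p) {pm pp : ℝ} (hpm : 1 < pm)
    (hbd : ∀ x ∈ Ω, pm ≤ p x ∧ p x ≤ pp) {h : ℝ} (hh : 0 < h)
    {ρ₀ ρ₁ : EuclideanSpace ℝ (Fin N) → ℝ}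
    {γ : Measure (EuclideanSpace ℝ (Fin N) × EuclideanSpace ℝ (Fin N))}
    (hγ : γ ∈ Couplings Ω ρ₀ ρ₁) : Integrable (varCost p h) γ ∧ 0 ≤ ∫ z, varCost p h z ∂γ := by
  obtain ⟨C, hC⟩ := cost_bdd hΩbd hpm hbd hh
  have hd := coup_dom hΩ hγ
  have := hγ.1
  constructor
  · refine Integrable.of_bound (cost_meas hp h).aestronglyMeasurable C ?_
    filter_upwards [hd] with z hz
    have := hC z.1 hz.1 z.2 hz.2
    rw [Real.norm_eq_abs, abs_of_nonneg this.1]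
    exact this.2
  · apply integral_nonneg_of_ae
    filter_upwards [hd] with z hz
    exact (hC z.1 hz.1 z.2 hz.2).1

lemma Wh_le {N : ℕ} {Ω : Set (EuclideanSpace ℝ (Fin N))} (hΩ : MeasurableSet Ω)
    (hΩbd : Bornology.IsBounded Ω)
    {p : EuclideanSpace ℝ (Fin N) → ℝ} (hp : Measurable p) {pm pp : ℝ} (hpm : 1 < pm)
    (hbd : ∀ x ∈ Ω, pm ≤ p x ∧ p x ≤ pp) {h : ℝ} (hh : 0 < h)
    {ρ₀ ρ₁ : EuclideanSpace ℝ (Fin N) → ℝ}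
    {γ : Measure (EuclideanSpace ℝ (Fin N) × EuclideanSpace ℝ (Fin N))}
    (hγ : γ ∈ Couplings Ω ρ₀ ρ₁) : Wh Ω p h ρ₀ ρ₁ ≤ ∫ z, varCost p h z ∂γ := by
  apply csInf_le
  · refine ⟨0, ?_⟩
    rintro c ⟨γ', hγ', rfl⟩
    exact (coup_int hΩ hΩbd hp hpm hbd hh hγ').2
  · exact ⟨γ, hγ, rfl⟩

lemma Wh_lt {N : ℕ} {Ω : Set (EuclideanSpace ℝ (Fin N))} 
    {p : EuclideanSpace ℝ (Fin N) → ℝ} {h : ℝ} 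
    {ρ₀ ρ₁ : EuclideanSpace ℝ (Fin N) → ℝ} (h0 : IsDensityOn Ω ρ₀) (h1 : IsDensityOn Ω ρ₁)
    {s : ℝ} (hs : 0 < s) :
    ∃ γ ∈ Couplings Ω ρ₀ ρ₁, ∫ z, varCost p h z ∂γ < Wh Ω p h ρ₀ ρ₁ + s := by
  have i0 := dm_prob h0
  have i1 := dm_prob h1
  obtain ⟨c, ⟨γ, hγ, rfl⟩, hc⟩ := exists_lt_of_csInf_lt 
    (s := {c : ℝ | ∃ γ ∈ Couplings Ω ρ₀ ρ₁, c = ∫ z, varCost p h z ∂γ}) 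
    ⟨_, (densMeasure Ω ρ₀).prod (densMeasure Ω ρ₁), 
      ⟨inferInstance, by simp [← Measure.fst.eq_1], by simp [← Measure.snd.eq_1]⟩, rfl⟩
    (show _ < Wh Ω p h ρ₀ ρ₁ + s by unfold Wh; linarith)
  exact ⟨γ, hγ, hc⟩

/-- Perturbation of a plan. -/
lemma perturb {N : ℕ} {Ω : Set (EuclideanSpace ℝ (Fin N))} (hΩ : MeasurableSet Ω)
    (hΩbd : Bornology.IsBounded Ω)
    {p : EuclideanSpace ℝ (Fin N) → ℝ} (hp : Measurable p) {pm pp : ℝ} (hpm : 1 < pm)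
    (hbd : ∀ x ∈ Ω, pm ≤ p x ∧ p x ≤ pp) {h : ℝ} (hh : 0 < h)
    {ρ₀ ρ₁ : EuclideanSpace ℝ (Fin N) → ℝ} (h0 : IsDensityOn Ω ρ₀) (h1 : IsDensityOn Ω ρ₁)
    {γ : Measure (EuclideanSpace ℝ (Fin N) × EuclideanSpace ℝ (Fin N))}
    (hγ : γ ∈ Couplings Ω ρ₀ ρ₁) {K1 K2 : Set (EuclideanSpace ℝ (Fin N))}
    (hK1 : MeasurableSet K1) (hK2 : MeasurableSet K2) {ε : ℝ} (hε : 0 < ε) (hε1 : ε < 1) :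
    ∃ v0 v1 : EuclideanSpace ℝ (Fin N) → ℝ, Measurable v0 ∧ Measurable v1 ∧
      (∀ x, 0 ≤ v0 x) ∧ (∀ x, 0 ≤ v1 x) ∧ (∀ x, v0 x ≤ ρ₀ x) ∧ (∀ x, v1 x ≤ ρ₁ x) ∧ 
      (∀ x, x ∉ K1 → v0 x = 0) ∧ (∀ x, x ∉ K2 → v1 x = 0) ∧ 
      Integrable v0 (volume.restrict Ω) ∧ Integrable v1 (volume.restrict Ω) ∧
      ∫ x in Ω, v0 x = γ.real (K1 ×ˢ K2) ∧ ∫ x in Ω, v1 x = γ.real (K1 ×ˢ K2) ∧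
      Wh Ω p h ρ₀ (fun x => ρ₁ x + ε * v0 x - ε * v1 x) ≤ ∫ z, varCost p h z ∂γ 
        - ε * ∫ z in K1 ×ˢ K2, varCost p h z ∂γ := by
  have hdom := coup_dom hΩ hγ
  have hint := (coup_int hΩ hΩbd hp hpm hbd hh hγ).1
  have i0 := hγ.1
  have hm0 := hγ.2.1
  have hm1 := hγ.2.2
  set K := K1 ×ˢ K2 with hK
  have hKm : MeasurableSet K := hK1.prod hK2
  set κ := γ.restrict K with hκ
  have hκγ : κ ≤ γ := Measure.restrict_le_self
  have hκ1 : (κ.map Prod.fst) K1ᶜ = 0 := by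
    rw [Measure.map_apply measurable_fst hK1.compl, hκ, 
      Measure.restrict_apply (measurable_fst hK1.compl)]
    convert measure_empty (μ := γ)
    ext z; simp [hK]; tauto
  have hκ2 : (κ.map Prod.snd) K2ᶜ = 0 := by
    rw [Measure.map_apply measurable_snd hK2.compl, hκ, 
      Measure.restrict_apply (measurable_snd hK2.compl)]
    convert measure_empty (μ := γ)
    ext z; simp [hK]; tauto
  obtain ⟨v0, hv0m, hv0n, hv0l, hv0s, hv0⟩ := dm_sub h0 (ν := κ.map Prod.fst) 
    (by rw [← hm0]; exact Measure.map_mono hκγ measurable_fst) hK1 hκ1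
  obtain ⟨v1, hv1m, hv1n, hv1l, hv1s, hv1⟩ := dm_sub h1 (ν := κ.map Prod.snd) 
    (by rw [← hm1]; exact Measure.map_mono hκγ measurable_snd) hK2 hκ2
  have f0 : IsFiniteMeasure (densMeasure Ω v0) := by rw [← hv0]; infer_instance
  have f1 : IsFiniteMeasure (densMeasure Ω v1) := by rw [← hv1]; infer_instance
  have hI0 := dm_integral (Ω := Ω) hv0m hv0n
  have hI1 := dm_integral (Ω := Ω) hv1m hv1n
  have hg0 : (densMeasure Ω v0).real univ = γ.real K := by
    rw [← hv0, measureReal_def, Measure.map_apply measurable_fst MeasurableSet.univ]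
    simp [hκ, measureReal_def]
  have hg1 : (densMeasure Ω v1).real univ = γ.real K := by
    rw [← hv1, measureReal_def, Measure.map_apply measurable_snd MeasurableSet.univ]
    simp [hκ, measureReal_def]
  refine ⟨v0, v1, hv0m, hv1m, hv0n, hv1n, hv0l, hv1l, hv0s, hv1s, hI0.1, hI1.1, 
    hI0.2.trans hg0, hI1.2.trans hg1, ?_⟩
  have hdm : Measurable (fun z : EuclideanSpace ℝ (Fin N) × EuclideanSpace ℝ (Fin N) => (z.1, z.1)) := by
    fun_prop
  set e := ENNReal.ofReal ε with he
  set e' := ENNReal.ofReal (1 - ε) with he'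
  have hee : e + e' = 1 := by
    rw [he, he', ← ENNReal.ofReal_add hε.le (by linarith)]; simp
  set κd := κ.map (fun z => (z.1, z.1)) with hκd
  let γ' := γ.restrict Kᶜ + e' • κ + e • κd
  have hsplit : γ.restrict Kᶜ + κ = γ := by
    rw [add_comm]; exact Measure.restrict_add_restrict_compl hKm
  have hsplit2 : e' • κ + e • κ = κ := by
    rw [← add_smul, add_comm, hee, one_smul]
  have hdf : κd.map Prod.fst = κ.map Prod.fst := by
    rw [hκd, Measure.map_map measurable_fst hdm]; rfl
  have hds : κd.map Prod.snd = κ.map Prod.fst := by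
    rw [hκd, Measure.map_map measurable_snd hdm]; rfl
  have hfst : γ'.map Prod.fst = densMeasure Ω ρ₀ := by
    rw [← hm0]
    conv_rhs => rw [← hsplit, ← hsplit2]
    simp only [γ', Measure.map_add _ _ measurable_fst, Measure.map_smul, hdf, add_assoc]
  have hf' : IsFiniteMeasure (γ'.map Prod.fst) := by
    rw [hfst]; have := dm_prob h0; infer_instance
  have hprob : IsProbabilityMeasure γ' := by
    have := dm_prob h0
    constructor
    have h2 : (γ'.map Prod.fst) univ = 1 := by rw [hfst]; exact measure_univ
    rwa [Measure.map_apply measurable_fst MeasurableSet.univ] at h2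
  have hsnd : γ'.map Prod.snd = densMeasure Ω (fun x => ρ₁ x + ε * v0 x - ε * v1 x) := by
    have e1 : γ'.map Prod.snd + e • densMeasure Ω v1 = densMeasure Ω ρ₁ + e • densMeasure Ω v0 := by
      rw [← hm1, ← hv0, ← hv1]
      conv_rhs => rw [← hsplit, ← hsplit2]
      simp only [γ', Measure.map_add _ _ measurable_snd, Measure.map_smul, hds, add_assoc]
      rw [add_comm (e • Measure.map Prod.fst κ), hsplit2]
    have e2 : densMeasure Ω (fun x => ρ₁ x + ε * v0 x - ε * v1 x) + e • densMeasure Ω v1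
        = densMeasure Ω ρ₁ + e • densMeasure Ω v0 := by
      rw [he, ← dm_smul Ω hv1m hε.le, ← dm_smul Ω hv0m hε.le, ← dm_add Ω, ← dm_add Ω h1.1 h1.2.1]
      · simp
      · intro x; have := hv0n x; positivity
      · have := h1.1; fun_prop
      · intro x
        have := hv0n x; have := hv1n x; have := hv1l x
        have : 0 ≤ ε * v0 x := by positivity
        nlinarith
      · intro x; have := hv1n x; positivity
    have f2 : IsFiniteMeasure (e • densMeasure Ω v1) := by
      refine ⟨?_⟩
      simp only [Measure.smul_apply, smul_eq_mul]
      exact ENNReal.mul_lt_top ENNReal.ofReal_lt_top (measure_lt_top _ _)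
    rw [← e2] at e1
    ext s hs
    have e3 := congrArg (fun m => m s) e1
    simp only [Measure.add_apply] at e3
    exact (ENNReal.add_left_inj (measure_ne_top _ s)).1 e3
  have hc : γ' ∈ Couplings Ω ρ₀ (fun x => ρ₁ x + ε * v0 x - ε * v1 x) := ⟨hprob, hfst, hsnd⟩
  refine (Wh_le hΩ hΩbd hp hpm hbd hh hc).trans (le_of_eq ?_)
  have hint' := (coup_int hΩ hΩbd hp hpm hbd hh hc).1
  have j12 := hint'.left_of_add_measure
  rw [integral_add_measure j12 hint'.right_of_add_measure, 
    integral_add_measure j12.left_of_add_measure j12.right_of_add_measure, integral_smul_measure,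
    integral_smul_measure]
  have hz : ∫ z, varCost p h z ∂κd = 0 := by
    rw [hκd, integral_map hdm.aemeasurable (cost_meas hp h).aestronglyMeasurable]
    apply integral_eq_zero_of_ae
    filter_upwards [ae_mono hκγ hdom] with z hz
    exact cost_diag (by linarith [(hbd z.1 hz.1).1])
  have hsum : ∫ z, varCost p h z ∂γ = ∫ z in Kᶜ, varCost p h z ∂γ + ∫ z, varCost p h z ∂κ := by
    rw [add_comm]; exact (integral_add_compl hKm hint).symm
  rw [hz, hsum, he', ENNReal.toReal_ofReal (by linarith)]
  simp only [smul_eq_mul]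
  ring

lemma sets_exist {N : ℕ} {Ω : Set (EuclideanSpace ℝ (Fin N))} (hΩ : MeasurableSet Ω)
    {ρ₀ ρ₁ : EuclideanSpace ℝ (Fin N) → ℝ} (h0 : IsDensityOn Ω ρ₀) (h1 : IsDensityOn Ω ρ₁)
    {M : ℝ} (hb : ∀ x ∈ Ω, ρ₀ x ≤ M) (hM : 0 < M)
    (hE : ¬ ∀ᵐ x ∂(volume.restrict Ω), ρ₁ x ≤ M) :
    ∃ (m L : ℝ) (K1 K2 : Set (EuclideanSpace ℝ (Fin N))), 0 < m ∧ 0 ≤ L ∧ IsCompact K1 ∧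
      IsCompact K2 ∧ K1 ⊆ Ω ∧ K2 ⊆ Ω ∧ (∀ x ∈ K1, ρ₁ x ≤ M) ∧ (∀ x ∈ K2, M < ρ₁ x ∧ ρ₁ x ≤ L) ∧
      ∀ γ ∈ Couplings Ω ρ₀ ρ₁, m ≤ γ.real (K1 ×ˢ K2) := by
  have i0 := dm_prob h0
  have i1 := dm_prob h1
  have hρ1 := h1.1
  have hρ0 := h0.1
  set E := {x | M < ρ₁ x} with hEdef
  have hEm : MeasurableSet E := measurableSet_lt measurable_const hρ1
  have hlt : densMeasure Ω ρ₀ E < densMeasure Ω ρ₁ E := by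
    have hfin : densMeasure Ω ρ₀ E ≠ ⊤ := measure_ne_top _ _
    unfold densMeasure at hfin ⊢
    rw [withDensity_apply _ hEm] at hfin ⊢
    rw [withDensity_apply _ hEm]
    refine lintegral_strict_mono ?_ (by fun_prop) hfin ?_
    · intro hz
      apply hE
      rw [Measure.restrict_eq_zero] at hz
      rw [ae_iff]
      simpa [hEdef] using hz
    · filter_upwards [ae_restrict_mem hEm, ae_restrict_of_ae (ae_restrict_mem hΩ)] with x hx hxΩ
      have : M < ρ₁ x := hx
      exact (ENNReal.ofReal_lt_ofReal_iff (hM.trans this)).2 ((hb x hxΩ).trans_lt this)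
  let F : ℕ → Set (EuclideanSpace ℝ (Fin N)) := fun n => {x | M < ρ₁ x ∧ ρ₁ x ≤ n}
  have hFm : ∀ n, MeasurableSet (F n) := fun n =>
    hEm.inter (measurableSet_le hρ1 measurable_const)
  have hFmono : Monotone F := by
    intro a b hab x hx
    exact ⟨hx.1, hx.2.trans (by exact_mod_cast hab)⟩
  have hFU : ⋃ n, F n = E := by
    ext x
    simp only [F, mem_iUnion, mem_ofPred_eq, hEdef]
    constructor
    · rintro ⟨n, hn⟩; exact hn.1
    · intro hx
      obtain ⟨n, hn⟩ := exists_nat_ge (ρ₁ x)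
      exact ⟨n, hx, hn⟩
  have htend := tendsto_measure_iUnion_atTop (μ := densMeasure Ω ρ₁) hFmono
  rw [hFU] at htend
  obtain ⟨n, hn⟩ := (htend.eventually_const_lt hlt).exists
  simp only [Function.comp] at hn
  have hn' : (densMeasure Ω ρ₀).real E < (densMeasure Ω ρ₁).real (F n) :=
    (ENNReal.toReal_lt_toReal (measure_ne_top _ _) (measure_ne_top _ _)).2 hn
  obtain ⟨d, hd⟩ : ∃ d, d = (densMeasure Ω ρ₁).real (F n) - (densMeasure Ω ρ₀).real E := ⟨_, rfl⟩
  have hd0 : 0 < d := by linarith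
  have hd3 : ENNReal.ofReal (d / 3) ≠ 0 := by
    simp; linarith
  obtain ⟨K1, hK1s, hK1c, hK1l⟩ := (hEm.compl.inter hΩ).exists_isCompact_sdiff_lt
    (μ := densMeasure Ω ρ₀) (measure_ne_top _ _) hd3
  obtain ⟨K2, hK2s, hK2c, hK2l⟩ := ((hFm n).inter hΩ).exists_isCompact_sdiff_lt
    (μ := densMeasure Ω ρ₁) (measure_ne_top _ _) hd3
  have aux : ∀ (μ : Measure (EuclideanSpace ℝ (Fin N))) [IsFiniteMeasure μ] (A K : Set _), 
      (∀ᵐ x ∂μ, x ∈ Ω) → K ⊆ A ∩ Ω → MeasurableSet K →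
      μ ((A ∩ Ω) \ K) < ENNReal.ofReal (d / 3) → μ.real A - d / 3 < μ.real K := by
    intro μ _ A K hμ hs hKm hl
    have e1 : μ.real ((A ∩ Ω) \ K) < d / 3 := by
      have := (ENNReal.toReal_lt_toReal (measure_ne_top _ _) ENNReal.ofReal_ne_top).2 hl
      rwa [ENNReal.toReal_ofReal (by linarith)] at this
    rw [measureReal_sdiff hs hKm] at e1
    have e2 : μ.real (A ∩ Ω) = μ.real A := by
      apply measureReal_congr
      filter_upwards [hμ] with x hx
      exact propext ⟨fun h => h.1, fun h => ⟨h, hx⟩⟩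
    linarith
  have b1 := aux _ _ _ (dm_dom hΩ) hK1s hK1c.measurableSet hK1l
  have b2 := aux _ _ _ (dm_dom hΩ) hK2s hK2c.measurableSet hK2l
  rw [probReal_compl_eq_one_sub hEm] at b1
  refine ⟨d / 3, n, K1, K2, by linarith, by positivity, hK1c, hK2c, fun x hx => (hK1s hx).2, 
    fun x hx => (hK2s hx).2, fun x hx => not_lt.1 (hK1s hx).1, fun x hx => (hK2s hx).1, ?_⟩
  rintro γ ⟨hγ, hγ0, hγ1⟩
  have c1 : (densMeasure Ω ρ₀).real K1ᶜ = γ.real (Prod.fst ⁻¹' K1ᶜ) := by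
    rw [← hγ0, map_measureReal_apply measurable_fst hK1c.measurableSet.compl]
  have c2 : (densMeasure Ω ρ₁).real K2 = γ.real (Prod.snd ⁻¹' K2) := by
    rw [← hγ1, map_measureReal_apply measurable_snd hK2c.measurableSet]
  rw [probReal_compl_eq_one_sub hK1c.measurableSet] at c1
  have c3 : γ.real (Prod.snd ⁻¹' K2) ≤ γ.real (K1 ×ˢ K2) + γ.real (Prod.fst ⁻¹' K1ᶜ) := by
    refine (measureReal_mono ?_).trans (measureReal_union_le _ _)
    intro z hz
    by_cases h : z.1 ∈ K1
    · exact Or.inl ⟨h, hz⟩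
    · exact Or.inr h
  linarith

/-- Maximum principle for the minimizing movement step. -/
theorem stmt13 {N : ℕ} (Ω : Set (EuclideanSpace ℝ (Fin N)))
    (hΩmeas : MeasurableSet Ω) (hΩbd : Bornology.IsBounded Ω) (hΩconv : Convex ℝ Ω)
    (hΩpos : 0 < volume Ω)
    (G : ℝ → ℝ) (hGconv : ConvexOn ℝ (Ici 0) G)
    (hGsm : ContDiffOn ℝ 2 G (Ioi 0)) (hG'' : ∀ t > 0, 0 < deriv (deriv G) t)
    (p : EuclideanSpace ℝ (Fin N) → ℝ) (hp : Measurable p)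
    (pm pp : ℝ) (hpm : 1 < pm) (hbd : ∀ x ∈ Ω, pm ≤ p x ∧ p x ≤ pp)
    (h : ℝ) (hh : 0 < h)
    (M₂ : ℝ) (hM : 1 / (volume Ω).toReal ≤ M₂)
    (ρ₀ : EuclideanSpace ℝ (Fin N) → ℝ) (hρ₀ : IsDensityOn Ω ρ₀)
    (hρ₀pos : ∀ x ∈ Ω, 0 < ρ₀ x) (hρ₀bd : ∀ x ∈ Ω, ρ₀ x ≤ M₂)
    (ρ1 : EuclideanSpace ℝ (Fin N) → ℝ) (hρ1 : IsDensityOn Ω ρ1)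
    (hmin : ∀ ρ, IsDensityOn Ω ρ →
      (∫ x in Ω, G (ρ1 x)) + Wh Ω p h ρ₀ ρ1 ≤ (∫ x in Ω, G (ρ x)) + Wh Ω p h ρ₀ ρ) :
    ∀ᵐ x ∂(volume.restrict Ω), ρ1 x ≤ M₂ := by
  by_contra hE
  have hvol : volume Ω < ⊤ := hΩbd.measure_lt_top
  have hfin : IsFiniteMeasure (volume.restrict Ω) := ⟨by simpa using hvol⟩
  have hM0 : 0 < M₂ := lt_of_lt_of_le (by 
    have := ENNReal.toReal_pos hΩpos.ne' hvol.ne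
    positivity) hM
  have hne : Ω.Nonempty := nonempty_of_measure_ne_zero hΩpos.ne'
  obtain ⟨m, L, K1, K2, hm, hL, hK1, hK2, hK1Ω, hK2Ω, hK1M, hK2M, hγK⟩ := 
    sets_exist hΩmeas hρ₀ hρ1 hρ₀bd hM0 hE
  have hdisj : Disjoint K1 K2 := by
    rw [disjoint_left]
    intro x hx1 hx2
    exact absurd (hK1M x hx1) (not_le.2 (hK2M x hx2).1)
  obtain ⟨δ, hδ, hδK⟩ := Metric.exists_pos_forall_lt_edist hK1 hK2.isClosed hdisj
  obtain ⟨c, hc, hcl⟩ := cost_lb hpm hbd hne hh (δ := (δ : ℝ)) (by exact_mod_cast hδ)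
  obtain ⟨ε, hε, hε1, hεG⟩ := G_eps hGsm hM0 (half_pos hc)
  obtain ⟨γ, hγ, hγc⟩ := Wh_lt (p := p) (h := h) hρ₀ hρ1 (s := ε * m * c / 2) (by positivity)
  obtain ⟨v0, v1, hv0m, hv1m, hv0n, hv1n, hv0l, hv1l, hv0s, hv1s, hv0i, hv1i, hv0I, hv1I, hW⟩ :=
    perturb hΩmeas hΩbd hp hpm hbd hh hρ₀ hρ1 hγ hK1.measurableSet hK2.measurableSet hε hε1
  have hgm := hγK γ hγ
  set g := γ.real (K1 ×ˢ K2) with hg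
  have hprob := hγ.1
  have hcost : c * g ≤ ∫ z in K1 ×ˢ K2, varCost p h z ∂γ := by
    have := setIntegral_mono_on (μ := γ) (s := K1 ×ˢ K2) (f := fun _ => c) (g := varCost p h)
      (integrable_const _).integrableOn (coup_int hΩmeas hΩbd hp hpm hbd hh hγ).1.integrableOn
      (hK1.measurableSet.prod hK2.measurableSet) (fun z hz => by
        refine hcl z.1 (hK1Ω hz.1) z.2 (hK2Ω hz.2) ?_
        have := hδK z.1 hz.1 z.2 hz.2
        rw [edist_nndist] at this
        have h2 : δ < nndist z.1 z.2 := by exact_mod_cast this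
        exact_mod_cast h2.le)
    rw [setIntegral_const, smul_eq_mul] at this
    linarith
  obtain ⟨r, hr⟩ : ∃ r : EuclideanSpace ℝ (Fin N) → ℝ, r = fun x => ρ1 x + ε * v0 x - ε * v1 x :=
    ⟨_, rfl⟩
  have hrx : ∀ x, r x = ρ1 x + ε * v0 x - ε * v1 x := fun x => by rw [hr]
  have hρ1m := hρ1.1
  have hrm : Measurable r := by rw [hr]; fun_prop
  have hr0 : ∀ x, 0 ≤ r x := by
    intro x
    have a1 := hv0n x; have a2 := hv1n x; have a3 := hv1l x
    have : 0 ≤ ε * v0 x := by positivity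
    rw [hrx]
    nlinarith
  have hrd : IsDensityOn Ω r := by
    refine ⟨hrm, hr0, ?_⟩
    simp only [hrx]
    rw [integral_sub (f := fun x => ρ1 x + ε * v0 x) ((dm_integrable hρ1).add (hv0i.const_mul ε))
        (hv1i.const_mul ε),
      integral_add (dm_integrable hρ1) (hv0i.const_mul ε), integral_const_mul, integral_const_mul,
      hv0I, hv1I, hρ1.2.2]
    ring
  have hmin' := hmin r hrd
  rw [← hr] at hW
  -- pointwise estimates
  have hpt : ∀ x ∈ Ω, G (r x) - G (ρ1 x) ≤ 
      deriv G (M₂ * (1 + ε)) * (ε * v0 x) - deriv G (M₂ * (1 - ε)) * (ε * v1 x) := by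
    intro x hx
    by_cases h1 : x ∈ K1
    · have e1 : v1 x = 0 := hv1s x (disjoint_left.1 hdisj h1)
      have e2 : r x = ρ1 x + ε * v0 x := by rw [hrx, e1]; ring
      have e3 : 0 ≤ ε * v0 x := mul_nonneg hε.le (hv0n x)
      have e4 : ε * v0 x ≤ ε * M₂ := by
        gcongr; exact (hv0l x).trans (hρ₀bd x hx)
      have := G_up hGconv hGsm (a := ρ1 x) (b := r x) (T := M₂ * (1 + ε)) (hρ1.2.1 x) (by linarith)
        (by have := hK1M x h1; linarith) (by positivity)
      rw [e2] at this ⊢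
      rw [e1]
      simpa using this
    · have e1 : v0 x = 0 := hv0s x h1
      by_cases h2 : x ∈ K2
      · have e2 : r x = ρ1 x - ε * v1 x := by rw [hrx, e1]; ring
        have e3 : 0 ≤ ε * v1 x := mul_nonneg hε.le (hv1n x)
        have e4 : ε * v1 x ≤ ε * ρ1 x := by
          gcongr; exact hv1l x
        have := G_down hGconv hGsm (a := ρ1 x) (b := r x) (T := M₂ * (1 - ε)) (by linarith)
          (by have := (hK2M x h2).1; nlinarith) (mul_pos hM0 (by linarith))
        rw [e2] at this ⊢
        rw [e1]
        simpa using this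
      · simp [hrx, e1, hv1s x h2]
  obtain ⟨B, hB⟩ := G_bdd hGconv hGsm (K := max L (2 * M₂)) (le_max_of_le_left hL)
  have hB0 : 0 ≤ B := (abs_nonneg _).trans (hB 0 le_rfl (le_max_of_le_left hL))
  have hGr := G_meas hGsm hrm hr0
  have hGρ := G_meas hGsm hρ1m hρ1.2.1
  have hDi : Integrable (fun x => G (r x) - G (ρ1 x)) (volume.restrict Ω) := by
    refine Integrable.of_bound (hGr.sub hGρ).aestronglyMeasurable (2 * B) ?_
    filter_upwards [ae_restrict_mem hΩmeas] with x hx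
    have key : ρ1 x ≤ max L (2 * M₂) → r x ≤ max L (2 * M₂) → ‖G (r x) - G (ρ1 x)‖ ≤ 2 * B := by
      intro a1 a2
      refine (norm_sub_le _ _).trans ?_
      have := hB _ (hr0 x) a2
      have := hB _ (hρ1.2.1 x) a1
      simp only [Real.norm_eq_abs]
      linarith
    by_cases h1 : x ∈ K1
    · have e1 : v1 x = 0 := hv1s x (disjoint_left.1 hdisj h1)
      have e4 : ε * v0 x ≤ 1 * M₂ := by
        gcongr
        · exact hv0n x
        · exact (hv0l x).trans (hρ₀bd x hx)
      have := hK1M x h1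
      apply key
      · exact le_max_of_le_right (by linarith)
      · exact le_max_of_le_right (by rw [hrx, e1]; linarith)
    · have e1 : v0 x = 0 := hv0s x h1
      by_cases h2 : x ∈ K2
      · have e3 : 0 ≤ ε * v1 x := mul_nonneg hε.le (hv1n x)
        have := (hK2M x h2).2
        apply key
        · exact le_max_of_le_left this
        · exact le_max_of_le_left (by rw [hrx, e1]; linarith)
      · simp [hrx, e1, hv1s x h2, hB0]
  have hDI : ∫ x in Ω, (G (r x) - G (ρ1 x)) ≤ 
      deriv G (M₂ * (1 + ε)) * (ε * g) - deriv G (M₂ * (1 - ε)) * (ε * g) := by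
    have j0 := (hv0i.const_mul ε).const_mul (deriv G (M₂ * (1 + ε)))
    have j1 := (hv1i.const_mul ε).const_mul (deriv G (M₂ * (1 - ε)))
    have := setIntegral_mono_on hDi (j0.sub j1) hΩmeas hpt
    refine this.trans (le_of_eq ?_)
    simp only [Pi.sub_apply]
    rw [integral_sub j0 j1]
    simp only [integral_const_mul]
    rw [hv0I, hv1I]
  have hg0 : 0 < g := hm.trans_le hgm
  have q1 : ε * (c * g) ≤ ε * ∫ z in K1 ×ˢ K2, varCost p h z ∂γ := by gcongr
  have q2 : ε * m * c / 2 ≤ ε * g * c / 2 := by gcongr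
  have q3 : 0 < ε * g * c := by positivity
  by_cases hint : Integrable (fun x => G (ρ1 x)) (volume.restrict Ω)
  · have hint2 : Integrable (fun x => G (r x)) (volume.restrict Ω) := by
      have := hDi.add hint
      refine this.congr (ae_of_all _ fun x => ?_)
      simp
    rw [integral_sub hint2 hint] at hDI
    have q4 : ε * g * (deriv G (M₂ * (1 + ε)) - deriv G (M₂ * (1 - ε))) < ε * g * (c / 2) := by
      gcongr
    linarith
  · have hint2 : ¬ Integrable (fun x => G (r x)) (volume.restrict Ω) := by
      intro hi
      apply hint
      refine (hi.sub hDi).congr (ae_of_all _ fun x => ?_)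
      simp
    rw [integral_undef hint, integral_undef hint2] at hmin'
    linarith
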